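/- Let n ≥ 1 and d ≥ 3 be integers with n(d−2) ≥ 2, and for k ∈ ℕ^{2n+2} set A_k := {(i,j) ∈ I_{nd−(2n+2)} × I_d : i + j = k}. Let k ∈ I_{(n+1)d−(2n+2)} satisfy 1 ≤ k_0 ≤ k_1 ≤ d−3, and let k' := (k_0−1, k_1+1, k_2, …, k_{2n+1}). Then #A_{k'} ≤ #A_k. -/

import Mathlib

open Finset

/-- `I m d N` is the set of tuples `(i_0,…,i_{m-1}) ∈ ℕ^m` with `0 ≤ i_e ≤ d-2`
for every `e` and `i_0 + ⋯ + i_{m-1} = N`. -/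
def I (m d N : ℕ) : Finset (Fin m → ℕ) :=
  (Fintype.piFinset fun _ : Fin m => Finset.Iic (d - 2)).filter fun i => ∑ e, i e = N

/-- `A n d k` is the set of pairs `(i,j) ∈ I_{nd-(2n+2)} × I_d` with `i + j = k`. -/
def A (n d : ℕ) (k : Fin (2 * n + 2) → ℕ) : Finset ((Fin (2 * n + 2) → ℕ) × (Fin (2 * n + 2) → ℕ)) :=
  ((I (2 * n + 2) d (n * d - (2 * n + 2))) ×ˢ (I (2 * n + 2) d d)).filter fun p => p.1 + p.2 = k

theorem sum_split (n : ℕ) (f : Fin (2 * n + 2) → ℕ) :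
    ∑ e, f e = f ⟨0, by omega⟩ + (f ⟨1, by omega⟩ + ∑ e : Fin (2 * n), f e.succ.succ) := by
  rw [Fin.sum_univ_succ, Fin.sum_univ_succ]; rfl

theorem mem_I' (m d N : ℕ) (i : Fin m → ℕ) :
    i ∈ I m d N ↔ (∀ e, i e ≤ d - 2) ∧ ∑ e, i e = N := by
  simp [I]

def shiftJ (n a b : ℕ) (j : Fin (2 * n + 2) → ℕ) : Fin (2 * n + 2) → ℕ := fun e =>
  if j ⟨1, by omega⟩ ≤ b then j e
  else if e.val = 0 then a else if e.val = 1 then j ⟨0, by omega⟩ + b + 1 - a else j e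

theorem stmt2 (n d : ℕ) (hn : 1 ≤ n) (hd : 3 ≤ d) (hnd : 2 ≤ n * (d - 2))
    (k : Fin (2 * n + 2) → ℕ) (hk : k ∈ I (2 * n + 2) d ((n + 1) * d - (2 * n + 2)))
    (h0 : 1 ≤ k ⟨0, by omega⟩) (h01 : k ⟨0, by omega⟩ ≤ k ⟨1, by omega⟩)
    (h1 : k ⟨1, by omega⟩ ≤ d - 3)
    (k' : Fin (2 * n + 2) → ℕ)
    (hk' : k' = Function.update
        (Function.update k ⟨0, by omega⟩ (k ⟨0, by omega⟩ - 1))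
        ⟨1, by omega⟩ (k ⟨1, by omega⟩ + 1)) :
    (A n d k').card ≤ (A n d k).card := by
  have hN : (n + 1) * d - (2 * n + 2) = (n * d - (2 * n + 2)) + d := by
    have h2 : n * d = n * (d - 2) + 2 * n := by
      obtain ⟨c, rfl⟩ : ∃ c, d = c + 2 := ⟨d - 2, by omega⟩
      simp only [Nat.add_sub_cancel]; ring
    rw [Nat.add_mul]; omega
  rw [mem_I', hN] at hk
  obtain ⟨hkb, hks⟩ := hk
  have z0 : 0 < 2 * n + 2 := by omega
  have z1 : 1 < 2 * n + 2 := by omega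
  set a := k ⟨0, by omega⟩ with ha
  set b := k ⟨1, by omega⟩ with hb
  have hk0 : k' ⟨0, by omega⟩ = a - 1 := by
    rw [hk']; simp
  have hk1 : k' ⟨1, by omega⟩ = b + 1 := by
    rw [hk']; simp
  have hk2 : ∀ e : Fin (2 * n + 2), e.val ≠ 0 → e.val ≠ 1 → k' e = k e := by
    intro e h0 h1
    rw [hk']; simp [Function.update_apply, Fin.ext_iff, h0, h1]
  have key : ∀ p ∈ A n d k', (∀ e, p.2 e ≤ k' e) ∧ (∀ e, p.1 e = k' e - p.2 e) ∧
      (∀ e, p.2 e ≤ d - 2) ∧ ∑ e, p.2 e = d := by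
    intro p hp
    simp only [A, mem_filter, mem_product, mem_I'] at hp
    obtain ⟨⟨-, h3, h4⟩, h5⟩ := hp
    have h6 : ∀ e, p.1 e + p.2 e = k' e := fun e => congrFun h5 e
    exact ⟨fun e => by have := h6 e; omega, fun e => by have := h6 e; omega, h3, h4⟩
  apply Finset.card_le_card_of_injOn
    (fun p => (k - shiftJ n a b p.2, shiftJ n a b p.2))
  · intro p hp
    obtain ⟨q1, -, q3, q4⟩ := key p hp
    have e0 := q1 ⟨0, by omega⟩
    have e1 := q1 ⟨1, by omega⟩
    rw [hk0] at e0
    rw [hk1] at e1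
    have hle : ∀ e, shiftJ n a b p.2 e ≤ k e := by
      intro e
      have := q1 e
      by_cases c0 : e.val = 0
      · obtain rfl : e = ⟨0, z0⟩ := Fin.ext c0
        simp only [shiftJ]
        split_ifs <;> omega
      by_cases c1 : e.val = 1
      · obtain rfl : e = ⟨1, z1⟩ := Fin.ext c1
        simp only [shiftJ]
        split_ifs <;> omega
      rw [hk2 e c0 c1] at this
      simp only [shiftJ, c0, c1, if_false, ite_self]
      exact this
    have hsum : ∑ e, shiftJ n a b p.2 e = d := by
      rw [← q4, sum_split, sum_split n p.2]
      have : ∀ e : Fin (2 * n), shiftJ n a b p.2 e.succ.succ = p.2 e.succ.succ := by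
        intro e
        simp [shiftJ]
      simp only [this]
      rw [← add_assoc, ← add_assoc]
      congr 1
      simp only [shiftJ, if_true, one_ne_zero, if_false]
      split_ifs
      · rfl
      · omega
    have hadd : (k - shiftJ n a b p.2) + shiftJ n a b p.2 = k := by
      funext e
      have := hle e
      simp only [Pi.add_apply, Pi.sub_apply]
      omega
    have hs2 : ∑ e, (k - shiftJ n a b p.2) e + ∑ e, shiftJ n a b p.2 e = ∑ e, k e := by
      rw [← Finset.sum_add_distrib]
      exact Finset.sum_congr rfl fun e _ => congrFun hadd e
    simp only [A, coe_filter, Set.mem_ofPred_eq, mem_product, mem_I']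
    refine ⟨⟨⟨fun e => ?_, by omega⟩, fun e => (hle e).trans (hkb e), hsum⟩, hadd⟩
    exact (Nat.sub_le _ _).trans (hkb e)
  · intro p hp q hq hpq
    obtain ⟨p1, p2, -, -⟩ := key p hp
    obtain ⟨q1, q2, -, -⟩ := key q hq
    have hs : ∀ e, shiftJ n a b p.2 e = shiftJ n a b q.2 e :=
      fun e => congrFun (congrArg Prod.snd hpq) e
    have ep0 := p1 ⟨0, by omega⟩
    have ep1 := p1 ⟨1, by omega⟩
    have eq0 := q1 ⟨0, by omega⟩
    have eq1 := q1 ⟨1, by omega⟩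
    rw [hk0] at ep0 eq0
    rw [hk1] at ep1 eq1
    have s0 := hs ⟨0, by omega⟩
    have s1 := hs ⟨1, by omega⟩
    simp only [shiftJ, if_true, one_ne_zero, if_false] at s0 s1
    have hj : p.2 = q.2 := by
      funext e
      by_cases c0 : e.val = 0
      · obtain rfl : e = ⟨0, z0⟩ := Fin.ext c0
        split_ifs at s0 s1 <;> omega
      by_cases c1 : e.val = 1
      · obtain rfl : e = ⟨1, z1⟩ := Fin.ext c1
        split_ifs at s0 s1 <;> omega
      have := hs e
      simpa only [shiftJ, c0, c1, if_false, ite_self] using this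
    refine Prod.ext ?_ hj
    funext e
    rw [p2, q2, hj]
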